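/- Let n ≥ 1 and 𝐢 ∈ 𝐒_n, write π = p(𝐢) ∈ S_n, and set (𝐣, q) = Φ(𝐢, n). Then q + 1 = π^{-1}(n), and p(𝐣) ∈ S_{n−1} is obtained from π by removing the assignment q+1 ↦ n. -/

import Mathlib

/-- `𝐒_n = [n-1] × [n-2] × ⋯ × [0]`: the sequences `(i_1,…,i_n)` with `0 ≤ i_k ≤ n-k`. -/
abbrev SzIndex (n : ℕ) := ∀ k : Fin n, Fin (n - (k : ℕ))

/-- The tail `(i_2,…,i_n)` of a sequence `(i_1,…,i_n) ∈ 𝐒_n`. -/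
def szTail {n : ℕ} (i : SzIndex (n + 1)) : SzIndex n :=
  fun k => Fin.cast (Nat.succ_sub_succ n k) (i k.succ)

/-- The permutation of `Fin (n+1)` sending `0` to `v` and `j+1` to `e(j)`, where values
`≥ v` are shifted up by one (i.e. obtained from `e` by adding the assignment `0 ↦ v`). -/
def insertPerm {n : ℕ} (v : Fin (n + 1)) (e : Equiv.Perm (Fin n)) :
    Equiv.Perm (Fin (n + 1)) :=
  (finSuccEquiv n).trans ((Equiv.optionCongr e).trans (finSuccEquiv' v).symm)

/-- The map `p : 𝐒_n → S_n`, defined recursively by `π(1) = i_1 + 1` and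
`π(k) = π'(k-1)` resp. `π'(k-1) + 1` according to whether `π'(k-1) ≤ i_1`,
where `π' = p(i_2,…,i_n)` (here realized 0-based on `Fin n`). -/
def pMap : ∀ n : ℕ, SzIndex n → Equiv.Perm (Fin n)
  | 0, _ => 1
  | n + 1, i => insertPerm (i ⟨0, Nat.succ_pos n⟩) (pMap n (szTail i))

/-- `IsRemoval π i πt` says that `πt ∈ S_n` is obtained from `π ∈ S_{n+1}` by removing the
assignment `i ↦ π(i)` (everything 0-based): remaining entries are renumbered, preserving
the mappings between them. -/
def IsRemoval {n : ℕ} (π : Equiv.Perm (Fin (n + 1))) (i : Fin (n + 1))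
    (πt : Equiv.Perm (Fin n)) : Prop :=
  ∀ j : Fin n,
    (πt j : ℕ) =
      if (j : ℕ) < (i : ℕ) then
        (if (π j.castSucc : ℕ) < (π i : ℕ) then (π j.castSucc : ℕ) else (π j.castSucc : ℕ) - 1)
      else
        (if (π j.succ : ℕ) < (π i : ℕ) then (π j.succ : ℕ) else (π j.succ : ℕ) - 1)

/-- Prepending a value to a sequence in `𝐒_n` (the value is clamped into the valid range
`[0, n]`, which is irrelevant for the in-range uses below). -/
def szCons {n : ℕ} (v : ℕ) (i : SzIndex n) : SzIndex (n + 1) := fun k =>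
  match k with
  | ⟨0, _⟩ => ⟨min v n, by
      show min v n < n + 1 - 0
      have := Nat.min_le_right v n; omega⟩
  | ⟨t + 1, ht⟩ =>
    ⟨((i ⟨t, by omega⟩ : Fin (n - t)) : ℕ), by
      have h1 : ((i ⟨t, by omega⟩ : Fin (n - t)) : ℕ) < n - t := (i ⟨t, by omega⟩).isLt
      show ((i ⟨t, by omega⟩ : Fin (n - t)) : ℕ) < n + 1 - (t + 1)
      omega⟩

/-- The map `Φ : 𝐒_{n+1} × [n+1] → 𝐒_n × [n]`, defined recursively on
`𝐢 = (i_1, 𝐢')`: if `r < i_1` then `Φ(𝐢, r) = ((i_1−1, 𝐣'), q'+1)` with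
`(𝐣', q') = Φ(𝐢', r)`; if `r ∈ {i_1, i_1+1}` then `Φ(𝐢, r) = (𝐢', 0)`;
if `r > i_1+1` then `Φ(𝐢, r) = ((i_1, 𝐣'), q'+1)` with `(𝐣', q') = Φ(𝐢', r−1)`.
(The second argument and the `[n]`-component are given as natural numbers.) -/
def Phi : ∀ (n : ℕ), SzIndex (n + 1) → ℕ → SzIndex n × ℕ
  | 0, _, _ => (fun k => k.elim0, 0)
  | n + 1, i, r =>
    let i1 : ℕ := (i ⟨0, Nat.succ_pos _⟩ : ℕ)
    if r < i1 then
      let p := Phi n (szTail i) r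
      (szCons (i1 - 1) p.1, p.2 + 1)
    else if r ≤ i1 + 1 then (szTail i, 0)
    else
      let p := Phi n (szTail i) (r - 1)
      (szCons i1 p.1, p.2 + 1)

theorem insertPerm_zero {n : ℕ} (v : Fin (n + 1)) (e : Equiv.Perm (Fin n)) :
    insertPerm v e 0 = v := by
  simp [insertPerm]

theorem insertPerm_succ {n : ℕ} (v : Fin (n + 1)) (e : Equiv.Perm (Fin n)) (j : Fin n) :
    insertPerm v e j.succ = v.succAbove (e j) := by
  simp [insertPerm]

theorem insertPerm_succ_val {n : ℕ} (v : Fin (n + 1)) (e : Equiv.Perm (Fin n)) (j : Fin n) :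
    (insertPerm v e j.succ : ℕ) = if (e j : ℕ) < v then (e j : ℕ) else e j + 1 := by
  rw [insertPerm_succ, Fin.succAbove]
  simp only [Fin.lt_def, Fin.val_castSucc]
  split_ifs <;> simp

theorem szTail_szCons {n : ℕ} (v : ℕ) (i : SzIndex n) : szTail (szCons v i) = i := rfl

theorem pMap_succ {n : ℕ} (i : SzIndex (n + 1)) :
    pMap (n + 1) i = insertPerm (i ⟨0, Nat.succ_pos n⟩) (pMap n (szTail i)) := rfl

theorem pMap_szCons {n : ℕ} (v : Fin (n + 1)) (i : SzIndex n) :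
    pMap (n + 1) (szCons v i) = insertPerm v (pMap n i) := by
  rw [pMap_succ, szTail_szCons]
  congr 1
  exact Fin.ext (Nat.min_eq_left (Nat.le_of_lt_succ v.isLt))

/-- Removing the maximal value commutes with inserting a smaller value in front. -/
theorem IsRemoval.insertPerm_succ {n : ℕ} {e : Equiv.Perm (Fin (n + 1))} {q : Fin (n + 1)}
    {d : Equiv.Perm (Fin n)} (hq : e q = Fin.last n) (h : IsRemoval e q d) (v : Fin (n + 1)) :
    IsRemoval (insertPerm v.castSucc e) q.succ (insertPerm v d) := by
  have hqv : (e q : ℕ) = n := by rw [hq]; rfl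
  have hv := v.isLt
  intro j
  refine Fin.cases ?_ (fun k => ?_) j
  · rw [insertPerm_succ_val, Fin.castSucc_zero, insertPerm_zero, insertPerm_zero, hqv]
    simp only [Fin.val_zero, Fin.val_succ, Fin.val_castSucc]
    split_ifs <;> omega
  · have hk := h k
    have hcast : (k : ℕ) < q → (e k.castSucc : ℕ) ≠ n := fun hlt heq => by
      have := e.injective (Fin.ext (heq.trans hqv.symm))
      rw [← this] at hlt
      simp at hlt
    have hsucc : ¬ (k : ℕ) < q → (e k.succ : ℕ) ≠ n := fun hlt heq => by
      have := e.injective (Fin.ext (heq.trans hqv.symm))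
      rw [← this] at hlt
      simp at hlt
    have h₁ := (e k.castSucc).isLt
    have h₂ := (e k.succ).isLt
    rw [← Fin.succ_castSucc]
    simp only [insertPerm_succ_val, Fin.val_succ, Fin.val_castSucc, hqv] at hk ⊢
    split_ifs at hk ⊢ <;> omega

/-- Removing a leading maximal value undoes its insertion. -/
theorem isRemoval_insertPerm_last {n : ℕ} (e : Equiv.Perm (Fin n)) :
    IsRemoval (insertPerm (Fin.last n) e) 0 e := by
  intro j
  have := (e j).isLt
  simp only [insertPerm_succ_val, insertPerm_zero, Fin.val_zero, Fin.val_last]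
  split_ifs <;> omega

/-- Let `n+1 ≥ 1`, `𝐢 ∈ 𝐒_{n+1}`, `π = p(𝐢) ∈ S_{n+1}`, and set
`(𝐣, q) = Φ(𝐢, n+1)`.  Then `q + 1 = π⁻¹(n+1)` (0-based: `q` is the position
`π⁻¹(n)` of the largest value), and `p(𝐣) ∈ S_n` is obtained from `π` by removing the
assignment `q+1 ↦ n+1`. -/
theorem szczarba_stmt19 (n : ℕ) (i : SzIndex (n + 1))
    (π : Equiv.Perm (Fin (n + 1))) (hπ : π = pMap (n + 1) i) :
    (Phi n i (n + 1)).2 = (π.symm (Fin.last n) : ℕ) ∧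
    IsRemoval π (π.symm (Fin.last n)) (pMap n (Phi n i (n + 1)).1) := by
  subst hπ
  suffices ∃ q : Fin (n + 1), pMap (n + 1) i q = Fin.last n ∧ (Phi n i (n + 1)).2 = q ∧
      IsRemoval (pMap (n + 1) i) q (pMap n (Phi n i (n + 1)).1) by
    obtain ⟨q, hq, hval, hrem⟩ := this
    rw [← hq, Equiv.symm_apply_apply]
    exact ⟨hval, hrem⟩
  induction n with
  | zero => exact ⟨0, Subsingleton.elim (α := Fin 1) _ _, rfl, fun j => j.elim0⟩
  | succ n ih =>
    obtain ⟨q, hq, hval, hrem⟩ := ih (szTail i)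
    rw [pMap_succ]
    generalize hv : (i ⟨0, Nat.succ_pos _⟩ : Fin (n + 1 + 1)) = v
    by_cases hlast : v = Fin.last (n + 1)
    · subst hlast
      have hPhi : Phi (n + 1) i (n + 1 + 1) = (szTail i, 0) := by
        simp only [Phi, hv, Fin.val_last]
        rw [if_neg (by omega), if_pos le_rfl]
      rw [hPhi]
      exact ⟨0, insertPerm_zero _ _, rfl, isRemoval_insertPerm_last _⟩
    · obtain ⟨w, rfl⟩ := Fin.exists_castSucc_eq.mpr hlast
      have hw := w.isLt
      have hPhi : Phi (n + 1) i (n + 1 + 1) =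
          (szCons w (Phi n (szTail i) (n + 1)).1, (Phi n (szTail i) (n + 1)).2 + 1) := by
        have h₁ : ¬ n + 1 + 1 < (w : ℕ) := by omega
        have h₂ : ¬ n + 1 + 1 ≤ (w : ℕ) + 1 := by omega
        simp only [Phi, hv, Fin.val_castSucc, h₁, h₂, if_false, Nat.add_sub_cancel]
      rw [hPhi]
      refine ⟨q.succ, ?_, by simp [hval], ?_⟩
      · rw [insertPerm_succ, hq]
        exact Fin.succAbove_ne_last_last hlast
      · rw [pMap_szCons]
        exact hrem.insertPerm_succ hq w
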